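/- Let N = (P, T, F, Υ, In) be a safe Petri net with transits, n ∈ ℕ, and N^MC the parallel-approach net. If N is safe, then N^MC is safe: for every marking M reachable in N^MC from In^MC and every transition τ ∈ T^MC enabled at M, post(τ) ∩ (M \ pre(τ)) = ∅. -/

import Mathlib

/-- A safe Petri net with transits `N = (P, T, F, Υ, In)`.
The flow relation `F ⊆ (P × T) ∪ (T × P)` is split into its two parts
`Fpt` (arcs from places to transitions) and `Ftp` (arcs from transitions to places).
The transit relation `Υ(t) ⊆ (pre(t) ∪ {►}) × post(t)` is encoded with `Option α`,
where `none` plays the role of the distinguished start symbol `►`. -/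
structure PNwT (α β : Type*) [DecidableEq α] [DecidableEq β] where
  P : Finset α
  T : Finset β
  Fpt : Finset (α × β)
  Ftp : Finset (β × α)
  Init : Finset α
  transit : β → Finset (Option α × α)
  fpt_mem : ∀ a ∈ Fpt, a.1 ∈ P ∧ a.2 ∈ T
  ftp_mem : ∀ a ∈ Ftp, a.1 ∈ T ∧ a.2 ∈ P
  init_sub : Init ⊆ P
  transit_pre : ∀ t ∈ T, ∀ x ∈ transit t, ∀ p : α, x.1 = some p → (p, t) ∈ Fpt
  transit_post : ∀ t ∈ T, ∀ x ∈ transit t, (t, x.2) ∈ Ftp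

variable {α β : Type*} [DecidableEq α] [DecidableEq β]

/-- `pre(t) = {p ∈ P | (p,t) ∈ F}`. -/
def PNwT.pre (N : PNwT α β) (t : β) : Finset α := N.P.filter fun p => (p, t) ∈ N.Fpt

/-- `post(t) = {p ∈ P | (t,p) ∈ F}`. -/
def PNwT.post (N : PNwT α β) (t : β) : Finset α := N.P.filter fun p => (t, p) ∈ N.Ftp

/-- Places of the parallel-approach net: original places `Sum.inl p`,
the fresh places `ι_i = Sum.inr (i, none)` and copies `[p]_i = Sum.inr (i, some p)`. -/
abbrev MCPlace (α : Type*) (n : ℕ) := α ⊕ (Fin n × Option α)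

/-- Transitions of the parallel-approach net: a pair `t_c = (t, c)` of an original
transition `t` and a tuple `c` choosing for each subnet `i` either a transit of `t`
(`some (x, p)`) or the marker `⊥` (`none`). -/
abbrev MCTran (α β : Type*) (n : ℕ) := β × (Fin n → Option (Option α × α))

/-- The set of places `P^MC` of the parallel-approach net. -/
def MCPlaces (N : PNwT α β) (n : ℕ) : Finset (MCPlace α n) :=
  N.P.image Sum.inl ∪
    ((Finset.univ : Finset (Fin n)) ×ˢ insert (none : Option α) (N.P.image some)).image Sum.inr

/-- The set of transitions `T^MC` of the parallel-approach net: for each `t ∈ T` and each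
tuple `c ∈ (Υ(t) ∪ {⊥})^n` exactly one transition `(t, c)`. -/
def MCTrans (N : PNwT α β) (n : ℕ) : Finset (MCTran α β n) :=
  N.T.biUnion fun t =>
    (Fintype.piFinset fun _ : Fin n => insert none ((N.transit t).image some)).image
      fun c => (t, c)

/-- The labeling `λ : T^MC → T`. -/
def MClabel (τ : MCTran α β n) : β := τ.1

/-- The place-to-transition part of `F^MC`. -/
def MCFpt (N : PNwT α β) (n : ℕ) : Set (MCPlace α n × MCTran α β n) :=
  { a | a.2 ∈ MCTrans N n ∧
      match a.1 with
      | Sum.inl p => (p, a.2.1) ∈ N.Fpt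
      | Sum.inr (i, none) => ∃ q, a.2.2 i = some (none, q)
      | Sum.inr (i, some x) => ∃ q, a.2.2 i = some (some x, q) }

/-- The transition-to-place part of `F^MC`. -/
def MCFtp (N : PNwT α β) (n : ℕ) : Set (MCTran α β n × MCPlace α n) :=
  { a | a.1 ∈ MCTrans N n ∧
      match a.2 with
      | Sum.inl q => (a.1.1, q) ∈ N.Ftp
      | Sum.inr (_, none) => False
      | Sum.inr (i, some q) => ∃ x, a.1.2 i = some (x, q) }

/-- The inhibitor arcs `I^MC`: if `c_i = ⊥` then `([p]_i, t_c) ∈ I^MC` for all `p ∈ pre(t)`. -/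
def MCInh (N : PNwT α β) (n : ℕ) : Set (MCPlace α n × MCTran α β n) :=
  { a | a.2 ∈ MCTrans N n ∧
      match a.1 with
      | Sum.inr (i, some p) => a.2.2 i = none ∧ p ∈ N.pre a.2.1
      | _ => False }

/-- The initial marking `In^MC = In ∪ {ι_1,…,ι_n}`. -/
def MCInit (N : PNwT α β) (n : ℕ) : Set (MCPlace α n) :=
  (Sum.inl '' (↑N.Init : Set α)) ∪ Set.range (fun i : Fin n => Sum.inr (i, none))

/-- The preset of a transition of the parallel-approach net. -/
def MCpre (N : PNwT α β) (n : ℕ) (τ : MCTran α β n) : Set (MCPlace α n) :=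
  { pl | (pl, τ) ∈ MCFpt N n }

/-- The postset of a transition of the parallel-approach net. -/
def MCpost (N : PNwT α β) (n : ℕ) (τ : MCTran α β n) : Set (MCPlace α n) :=
  { pl | (τ, pl) ∈ MCFtp N n }

/-- Firing `M [τ⟩ M'` in the parallel-approach net (with inhibitor arcs):
`τ` is a transition of `N^MC`, `pre(τ) ⊆ M`, no place connected to `τ` by an
inhibitor arc is in `M`, and `M' = (M \ pre(τ)) ∪ post(τ)`. -/
def MCfire (N : PNwT α β) (n : ℕ) (M : Set (MCPlace α n)) (τ : MCTran α β n)
    (M' : Set (MCPlace α n)) : Prop :=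
  τ ∈ MCTrans N n ∧ MCpre N n τ ⊆ M ∧ (∀ pl, (pl, τ) ∈ MCInh N n → pl ∉ M) ∧
  M' = (M \ MCpre N n τ) ∪ MCpost N n τ

/-- Firing `M [t⟩ M'` in the original net (no inhibitor arcs). -/
def PNwT.fire (N : PNwT α β) (M : Set α) (t : β) (M' : Set α) : Prop :=
  t ∈ N.T ∧ (↑(N.pre t) : Set α) ⊆ M ∧ M' = (M \ ↑(N.pre t)) ∪ ↑(N.post t)

/-- Reachable markings of the parallel-approach net from `In^MC`. -/
def MCreach (N : PNwT α β) (n : ℕ) : Set (Set (MCPlace α n)) :=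
  { M | Relation.ReflTransGen (fun A B => ∃ τ, MCfire N n A τ B) (MCInit N n) M }

/-- Reachable markings of the original net `N` from `In`. -/
def NReach (N : PNwT α β) : Set (Set α) :=
  { M | Relation.ReflTransGen (fun A B => ∃ t, N.fire A t B) (↑N.Init) M }

/-- Safety of the original net: for every reachable marking `M` and every transition `t`
enabled at `M`, `post(t) ∩ (M \ pre(t)) = ∅`. -/
def PNwT.Safe (N : PNwT α β) : Prop :=
  ∀ M ∈ NReach N, ∀ t ∈ N.T, (↑(N.pre t) : Set α) ⊆ M →
    (↑(N.post t) : Set α) ∩ (M \ ↑(N.pre t)) = ∅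

theorem fst_mem_of_mem_MCTrans {N : PNwT α β} {n : ℕ} {τ : MCTran α β n}
    (hτ : τ ∈ MCTrans N n) : τ.1 ∈ N.T := by
  simp only [MCTrans, Finset.mem_biUnion, Finset.mem_image] at hτ
  obtain ⟨t, ht, c, -, rfl⟩ := hτ
  exact ht

theorem PNwT.mem_pre {N : PNwT α β} {t : β} {p : α} : p ∈ N.pre t ↔ (p, t) ∈ N.Fpt := by
  simp only [PNwT.pre, Finset.mem_filter, and_iff_right_iff_imp]
  exact fun h => (N.fpt_mem _ h).1

theorem PNwT.mem_post {N : PNwT α β} {t : β} {p : α} : p ∈ N.post t ↔ (t, p) ∈ N.Ftp := by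
  simp only [PNwT.post, Finset.mem_filter, and_iff_right_iff_imp]
  exact fun h => (N.ftp_mem _ h).2

theorem inl_mem_MCpre {N : PNwT α β} {n : ℕ} {τ : MCTran α β n} (hτ : τ ∈ MCTrans N n)
    {p : α} : Sum.inl p ∈ MCpre N n τ ↔ p ∈ N.pre τ.1 := by
  simp [MCpre, MCFpt, hτ, PNwT.mem_pre]

theorem inl_mem_MCpost {N : PNwT α β} {n : ℕ} {τ : MCTran α β n} (hτ : τ ∈ MCTrans N n)
    {p : α} : Sum.inl p ∈ MCpost N n τ ↔ p ∈ N.post τ.1 := by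
  simp [MCpost, MCFtp, hτ, PNwT.mem_post]

theorem inr_mem_MCpre {N : PNwT α β} {n : ℕ} {τ : MCTran α β n} (hτ : τ ∈ MCTrans N n)
    {i : Fin n} {x : Option α} :
    Sum.inr (i, x) ∈ MCpre N n τ ↔ ∃ q, τ.2 i = some (x, q) := by
  cases x <;> simp [MCpre, MCFpt, hτ]

theorem inr_mem_MCpost {N : PNwT α β} {n : ℕ} {τ : MCTran α β n} (hτ : τ ∈ MCTrans N n)
    {i : Fin n} {y : Option α} :
    Sum.inr (i, y) ∈ MCpost N n τ ↔ ∃ x q, τ.2 i = some (x, q) ∧ y = some q := by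
  cases y <;> simp [MCpost, MCFtp, hτ]

/-- Firing in the parallel-approach net projects to firing in the original net. -/
theorem MCfire.fire_preimage_inl {N : PNwT α β} {n : ℕ} {M M' : Set (MCPlace α n)}
    {τ : MCTran α β n} (h : MCfire N n M τ M') :
    N.fire (Sum.inl ⁻¹' M) τ.1 (Sum.inl ⁻¹' M') := by
  obtain ⟨hτ, hpre, -, rfl⟩ := h
  refine ⟨fst_mem_of_mem_MCTrans hτ, fun p hp => hpre ((inl_mem_MCpre hτ).2 hp), ?_⟩
  ext p
  simp [inl_mem_MCpre hτ, inl_mem_MCpost hτ]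

theorem preimage_inl_mem_NReach {N : PNwT α β} {n : ℕ} {M : Set (MCPlace α n)}
    (hM : M ∈ MCreach N n) : Sum.inl ⁻¹' M ∈ NReach N := by
  have hinit : Sum.inl ⁻¹' MCInit N n = (↑N.Init : Set α) := by
    ext p
    simp [MCInit]
  induction hM with
  | refl => exact hinit ▸ Relation.ReflTransGen.refl
  | tail _ hfire ih =>
    obtain ⟨τ, h⟩ := hfire
    exact ih.tail ⟨τ.1, h.fire_preimage_inl⟩

/-- Each subnet carries at most one token in a reachable marking. -/
theorem eq_of_inr_mem_of_mem_MCreach {N : PNwT α β} {n : ℕ} {M : Set (MCPlace α n)}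
    (hM : M ∈ MCreach N n) (i : Fin n) {x y : Option α}
    (hx : Sum.inr (i, x) ∈ M) (hy : Sum.inr (i, y) ∈ M) : x = y := by
  induction hM generalizing x y with
  | refl => simp_all [MCInit]
  | @tail A _ _ hfire ih =>
    obtain ⟨τ, hτ, hpre, -, rfl⟩ := hfire
    simp only [Set.mem_union, Set.mem_sdiff, inr_mem_MCpre hτ, inr_mem_MCpost hτ] at hx hy
    cases hc : τ.2 i with
    | none =>
      simp only [hc] at hx hy
      exact ih (by simpa using hx) (by simpa using hy)
    | some c =>
      have hmem := hpre ((inr_mem_MCpre hτ).2 ⟨c.2, hc⟩)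
      have key {z : Option α} (hz : (Sum.inr (i, z) ∈ A ∧ ¬∃ q, τ.2 i = some (z, q)) ∨
          ∃ x q, τ.2 i = some (x, q) ∧ z = some q) : z = some c.2 := by
        rcases hz with ⟨hz, hne⟩ | ⟨x, q, hq, rfl⟩
        · exact absurd ⟨c.2, ih hz hmem ▸ hc⟩ hne
        · cases hc.symm.trans hq
          rfl
      rw [key hx, key hy]

/-- if `N` is safe, then `N^MC` is safe: for every marking `M` reachable in
`N^MC` from `In^MC` and every transition `τ ∈ T^MC` enabled at `M` (preset contained in
`M` and no inhibitor place of `τ` in `M`), `post(τ) ∩ (M \ pre(τ)) = ∅`. -/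
theorem mc_safe (N : PNwT α β) (n : ℕ) (hsafe : N.Safe)
    (M : Set (MCPlace α n)) (hM : M ∈ MCreach N n) (τ : MCTran α β n)
    (hτ : τ ∈ MCTrans N n) (hpre : MCpre N n τ ⊆ M)
    (hinh : ∀ pl, (pl, τ) ∈ MCInh N n → pl ∉ M) :
    MCpost N n τ ∩ (M \ MCpre N n τ) = ∅ := by
  refine Set.eq_empty_of_forall_notMem ?_
  rintro (p | ⟨i, y⟩) ⟨hpost, hmem, hnot⟩
  · have hempty := hsafe _ (preimage_inl_mem_NReach hM) τ.1 (fst_mem_of_mem_MCTrans hτ)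
      fun p hp => hpre ((inl_mem_MCpre hτ).2 hp)
    exact Set.eq_empty_iff_forall_notMem.1 hempty p
      ⟨(inl_mem_MCpost hτ).1 hpost, hmem, fun hp => hnot ((inl_mem_MCpre hτ).2 hp)⟩
  · obtain ⟨x, q, hq, -⟩ := (inr_mem_MCpost hτ).1 hpost
    have hx := (inr_mem_MCpre hτ).2 ⟨q, hq⟩
    exact hnot (eq_of_inr_mem_of_mem_MCreach hM i (hpre hx) hmem ▸ hx)
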